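/- arXiv:1507.06886 — 2 statements merged into one kernel-verified Lean document; each statement's English description precedes it below -/
import Mathlib

section
/- Let p ≡ 7 (mod 8) be a prime and e ≥ 1 an integer such that the multiplicative order of 2 modulo p^e equals φ(p^e)/2. If α ∈ ℤ[ζ] satisfies α·ᾱ = 2^n for some positive integer n, then there exists a unique residue class i modulo p^e such that α·ζ^i lies in the ring of integers O_L of L = ℚ(√−p). -/
open scoped BigOperators nonZeroDivisors

noncomputable def primRoot (m : ℕ) : ℂ :=
  Complex.exp (2 * Real.pi * Complex.I / m)

/-- The complex number `√(-p)`, realized as `√p · i`. -/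
noncomputable def sqrtNeg (p : ℕ) : ℂ :=
  (Real.sqrt p : ℂ) * Complex.I

open NumberField

section FrobeniusAtTwo

variable {K : Type*} [Field K] [NumberField K]

theorem exists_eq_sq_add_two_mul_of_mem_adjoin {ζ : K} (σ : K ≃ₐ[ℚ] K) (hσ : σ ζ = ζ ^ 2)
    {x : K} (hx : x ∈ Algebra.adjoin ℤ {ζ}) :
    ∃ y ∈ Algebra.adjoin ℤ {ζ}, σ x = x ^ 2 + 2 * y := by
  induction hx using Algebra.adjoin_induction with
  | mem x hx =>
    rw [Set.mem_singleton_iff] at hx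
    exact ⟨0, zero_mem _, by simp [hx, hσ]⟩
  | algebraMap n =>
    obtain ⟨k, hk⟩ := even_iff_two_dvd.mp (Int.even_mul_pred_self n)
    refine ⟨algebraMap ℤ K (-k), Subalgebra.algebraMap_mem _ _, ?_⟩
    have hk' : (n : K) * (n - 1) = 2 * k := by exact_mod_cast hk
    simp only [algebraMap_int_eq, eq_intCast, map_intCast, Int.cast_neg]
    linear_combination -hk'
  | add a b ha hb iha ihb =>
    obtain ⟨y, hy, h⟩ := iha
    obtain ⟨z, hz, h'⟩ := ihb
    refine ⟨y + z - a * b, sub_mem (add_mem hy hz) (mul_mem ha hb), ?_⟩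
    rw [map_add, h, h']
    ring
  | mul a b ha hb iha ihb =>
    obtain ⟨y, hy, h⟩ := iha
    obtain ⟨z, hz, h'⟩ := ihb
    refine ⟨a ^ 2 * z + y * b ^ 2 + 2 * (y * z), ?_, ?_⟩
    · exact add_mem (add_mem (mul_mem (pow_mem ha 2) hz) (mul_mem hy (pow_mem hb 2)))
        (mul_mem (ofNat_mem _ 2) (mul_mem hy hz))
    · rw [map_mul, h, h']
      ring

theorem exists_mapRingEquiv_eq_sq_add_two_mul {p k : ℕ} [Fact p.Prime]
    [IsCyclotomicExtension {p ^ k} ℚ K] {ζ : K} (hζ : IsPrimitiveRoot ζ (p ^ k))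
    (σ : K ≃ₐ[ℚ] K) (hσ : σ ζ = ζ ^ 2) (x : 𝓞 K) :
    ∃ y : 𝓞 K, RingOfIntegers.mapRingEquiv (σ : K ≃+* K) x = x ^ 2 + 2 * y := by
  have hcl := IsCyclotomicExtension.Rat.isIntegralClosure_adjoin_singleton_of_prime_pow hζ
  obtain ⟨⟨a, ha⟩, hax⟩ := hcl.isIntegral_iff.mp x.isIntegral_coe
  obtain ⟨y, hy, h⟩ := exists_eq_sq_add_two_mul_of_mem_adjoin σ hσ ha
  change a = x at hax
  have hyint : IsIntegral ℤ y := hcl.isIntegral_iff.mpr ⟨⟨y, hy⟩, rfl⟩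
  obtain ⟨y, rfl⟩ : ∃ z : 𝓞 K, (z : K) = y := ⟨⟨y, hyint⟩, rfl⟩
  refine ⟨y, RingOfIntegers.coe_injective ?_⟩
  rw [hax] at h
  rw [map_add, map_mul, map_pow, map_ofNat]
  exact h

theorem map_eq_self_of_dvd_two_pow {p k : ℕ} [Fact p.Prime]
    [IsCyclotomicExtension {p ^ k} ℚ K] {ζ : K} (hζ : IsPrimitiveRoot ζ (p ^ k))
    (σ : K ≃ₐ[ℚ] K) (hσ : σ ζ = ζ ^ 2) (n : ℕ) (I : Ideal (𝓞 K))
    (hI : I ∣ Ideal.span {2} ^ n) :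
    I.map (RingOfIntegers.mapRingEquiv (σ : K ≃+* K)) = I := by
  induction I using UniqueFactorizationMonoid.induction_on_prime with
  | h₁ => exact Ideal.map_bot
  | h₂ J hJ =>
    rw [Ideal.isUnit_iff.mp hJ]
    exact Ideal.map_top _
  | h₃ J P hJ hP ih =>
    rw [Ideal.map_mul, ih ((dvd_mul_left _ _).trans hI)]
    congr 1
    have hPprime := Ideal.isPrime_of_prime hP
    have hPmax : P.IsMaximal := hPprime.isMaximal hP.ne_zero
    have hP2 : (2 : 𝓞 K) ∈ P := by
      have := hP.dvd_of_dvd_pow ((dvd_mul_right _ _).trans hI)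
      rwa [Ideal.dvd_span_singleton] at this
    have hmap := Ideal.map_isMaximal_of_equiv (RingOfIntegers.mapRingEquiv (σ : K ≃+* K)) (p := P)
    refine hmap.eq_of_le hPprime.ne_top (Ideal.map_le_iff_le_comap.mpr fun x hx => ?_)
    obtain ⟨y, hy⟩ := exists_mapRingEquiv_eq_sq_add_two_mul hζ σ hσ x
    rw [Ideal.mem_comap, hy]
    exact add_mem (P.pow_mem_of_mem hx 2 two_pos) (P.mul_mem_right y hP2)

end FrobeniusAtTwo

section Conjugation

variable {K : Type*} [Field K] [NumberField K] {N : ℕ} [NeZero N]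
  [IsCyclotomicExtension {N} ℚ K]

theorem exists_algEquiv_apply_eq_pow {ζ : K} (hζ : IsPrimitiveRoot ζ N) (u : (ZMod N)ˣ) :
    ∃ σ : K ≃ₐ[ℚ] K, σ ζ = ζ ^ (u : ZMod N).val ∧ orderOf σ = orderOf (u : ZMod N) := by
  refine ⟨(IsCyclotomicExtension.Rat.galEquivZMod N K).symm u, ?_, ?_⟩
  · rw [IsCyclotomicExtension.Rat.galEquivZMod_apply_of_pow_eq N K _ hζ.pow_eq_one,
      MulEquiv.apply_symm_apply]
  · rw [MulEquiv.orderOf_eq, orderOf_units]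

theorem exists_algEquiv_embedding_apply_eq_conj (K : Type*) [Field K] [NumberField K] (N : ℕ)
    [NeZero N] [IsCyclotomicExtension {N} ℚ K] :
    ∃ c : K ≃ₐ[ℚ] K, ∀ (φ : K →+* ℂ) (x : K), φ (c x) = starRingEnd ℂ (φ x) := by
  have hζ := IsCyclotomicExtension.zeta_spec N ℚ K
  set ζ := IsCyclotomicExtension.zeta N ℚ K
  obtain ⟨c, hc, -⟩ := exists_algEquiv_apply_eq_pow hζ (-1)
  have hcζ : c ζ * ζ = 1 := by
    rw [hc, ← pow_succ, hζ.pow_eq_one_iff_dvd, ← ZMod.natCast_eq_zero_iff]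
    simp
  refine ⟨c, fun φ => DFunLike.congr_fun (?_ :
    (φ.comp (c : K →+* K)).toRatAlgHom = ((starRingEnd ℂ).comp φ).toRatAlgHom)⟩
  apply (hζ.powerBasis ℚ).algHom_ext
  have h1 : φ (c ζ) * φ ζ = 1 := by rw [← map_mul, hcζ, map_one]
  have h2 : starRingEnd ℂ (φ ζ) * φ ζ = 1 := by
    rw [mul_comm, Complex.mul_conj',
      (hζ.map_of_injective φ.injective).norm'_eq_one (NeZero.ne N)]
    simp
  simpa using mul_right_cancel₀ (right_ne_zero_of_mul_eq_one h1) (h1.trans h2.symm)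

end Conjugation

section PrimePower

variable {K : Type*} [Field K] [NumberField K] {p k : ℕ} [Fact p.Prime]
  [IsCyclotomicExtension {p ^ k} ℚ K]

theorem exists_apply_eq_pow_mul_or_neg_pow_mul (hodd : Odd (p ^ k)) {ζ : K}
    (hζ : IsPrimitiveRoot ζ (p ^ k)) {σ : K ≃ₐ[ℚ] K} (hσ : σ ζ = ζ ^ 2) (ι : K →+* ℂ) {n : ℕ}
    {α : 𝓞 K} (hα : ι α * starRingEnd ℂ (ι α) = 2 ^ n) :
    ∃ r, σ α = ζ ^ r * α ∨ σ α = -(ζ ^ r * α) := by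
  obtain ⟨c, hc⟩ := exists_algEquiv_embedding_apply_eq_conj K (p ^ k)
  have hαc : α * c α = (2 : K) ^ n := by
    apply ι.injective
    rw [map_mul, hc, hα, map_pow, map_ofNat]
  have hNorm (φ : K →+* ℂ) : ‖φ α‖ ^ 2 = 2 ^ n := by
    have h := congrArg φ hαc
    rw [map_mul, hc, Complex.mul_conj', map_pow, map_ofNat] at h
    exact_mod_cast h
  have hdvd : Ideal.span {α} ∣ Ideal.span {2} ^ n := by
    rw [Ideal.span_singleton_pow, Ideal.dvd_span_singleton, Ideal.mem_span_singleton]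
    refine ⟨RingOfIntegers.mapRingEquiv (c : K ≃+* K) α, RingOfIntegers.coe_injective ?_⟩
    rw [map_pow, map_ofNat, map_mul]
    exact hαc.symm
  have hspan := map_eq_self_of_dvd_two_pow hζ σ hσ n _ hdvd
  rw [Ideal.map_span, Set.image_singleton, Ideal.span_singleton_eq_span_singleton] at hspan
  obtain ⟨u, hu⟩ := hspan.symm
  have hu' : σ α = u * α := by
    rw [mul_comm]
    exact (congrArg (algebraMap (𝓞 K) K) hu).symm.trans (map_mul _ _ _)
  obtain ⟨m, hm, hum⟩ := NumberField.Embeddings.pow_eq_one_of_norm_eq_one K ℂ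
    (x := ((u : 𝓞 K) : K)) (RingOfIntegers.isIntegral_coe _) fun φ => by
      have h1 := hNorm (φ.comp (σ : K →+* K))
      have h2 := hNorm φ
      have h3 : (φ.comp (σ : K →+* K)) α = φ u * φ α := by
        rw [← map_mul, ← hu']; rfl
      rw [h3, norm_mul, mul_pow, h2] at h1
      have h4 : ‖φ u‖ ^ 2 = 1 := mul_right_cancel₀ (by positivity) (h1.trans (one_mul _).symm)
      exact (pow_eq_one_iff_of_nonneg (norm_nonneg _) two_ne_zero).mp h4
  obtain ⟨r, -, hr⟩ := hζ.exists_pow_or_neg_mul_pow_of_isOfFinOrder hodd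
    (isOfFinOrder_iff_pow_eq_one.mpr ⟨m, hm, hum⟩)
  rw [hu']
  refine ⟨r, hr.imp (fun h => congrArg (· * (α : K)) h) (fun h => ?_)⟩
  rw [← neg_mul]
  exact congrArg (· * (α : K)) h

/-- If `σ` has odd order, the sign in `exists_apply_eq_pow_mul_or_neg_pow_mul` is positive. -/
theorem exists_apply_eq_pow_mul (hodd : Odd (p ^ k)) {ζ : K}
    (hζ : IsPrimitiveRoot ζ (p ^ k)) {σ : K ≃ₐ[ℚ] K} (hσ : σ ζ = ζ ^ 2) (hσodd : Odd (orderOf σ))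
    (ι : K →+* ℂ) {n : ℕ} {α : 𝓞 K} (hα : ι α * starRingEnd ℂ (ι α) = 2 ^ n) :
    ∃ r, σ α = ζ ^ r * α := by
  obtain ⟨r, hr | hr⟩ := exists_apply_eq_pow_mul_or_neg_pow_mul hodd hζ hσ ι hα
  · exact ⟨r, hr⟩
  have hζ0 : ζ ≠ 0 := hζ.ne_zero (NeZero.ne _)
  set β : K := α * (ζ ^ r)⁻¹
  have hβ : σ β = -β := by
    simp only [β, map_mul, map_inv₀, map_pow, hσ, hr]
    field_simp
    ring
  have hpow (m : ℕ) : (σ ^ m) β = (-1) ^ m * β := by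
    induction m with
    | zero => simp
    | succ m ih => rw [pow_succ', AlgEquiv.mul_apply, ih]; simp [hβ, pow_succ]
  have h0 := hpow (orderOf σ)
  rw [pow_orderOf_eq_one, hσodd.neg_one_pow, AlgEquiv.one_apply, neg_one_mul, self_eq_neg] at h0
  have hα0 : (α : K) = 0 := by simpa [β, hζ0] using h0
  refine ⟨0, by simp [hα0]⟩

omit [IsCyclotomicExtension {p ^ k} ℚ K] in
theorem exists_sq_eq_neg (hk : k ≠ 0) (hp : p % 4 = 3) {ζ : K} (hζ : IsPrimitiveRoot ζ (p ^ k)) :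
    ∃ s : K, s ^ 2 = -p := by
  have hp2 : ringChar (ZMod p) ≠ 2 := by
    rw [ZMod.ringChar_zmod_n]; omega
  have hζp : IsPrimitiveRoot (ζ ^ p ^ (k - 1)) p :=
    hζ.pow (NeZero.pos _) (by rw [← pow_succ, Nat.sub_add_cancel (Nat.pos_of_ne_zero hk)])
  have hinj := (algebraMap ℤ K).injective_int
  refine ⟨_, (gaussSum_sq (χ := (quadraticChar (ZMod p)).ringHomComp (algebraMap ℤ K))
    ((MulChar.ringHomComp_ne_one_iff hinj).mpr (quadraticChar_ne_one hp2))
    ((quadraticChar_isQuadratic _).comp _)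
    (AddChar.zmodChar_primitive_of_primitive_root p hζp)).trans ?_⟩
  rw [MulChar.ringHomComp_apply, quadraticChar_neg_one hp2, ZMod.card,
    ZMod.χ₄_nat_three_mod_four hp]
  simp

end PrimePower

section Degree

variable {K : Type*} [Field K] [NumberField K]

theorem mem_fixedField_zpowers_iff {σ : K ≃ₐ[ℚ] K} {x : K} :
    x ∈ IntermediateField.fixedField (Subgroup.zpowers σ) ↔ σ x = x := by
  rw [IntermediateField.mem_fixedField_iff]
  refine ⟨fun h => h σ (Subgroup.mem_zpowers σ), fun h τ hτ => ?_⟩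
  have hmem : σ ∈ MulAction.stabilizer (K ≃ₐ[ℚ] K) x := h
  exact (Subgroup.zpowers_le.mpr hmem) hτ

theorem adjoin_eq_fixedField_zpowers {σ : K ≃ₐ[ℚ] K} (hσodd : Odd (orderOf σ))
    (hfin : Module.finrank ℚ K = 2 * orderOf σ) {s : K} {d : ℕ} (hd : d ≠ 0)
    (hs : s ^ 2 = -d) :
    IntermediateField.adjoin ℚ {s} = IntermediateField.fixedField (Subgroup.zpowers σ) := by
  set F := IntermediateField.fixedField (Subgroup.zpowers σ)
  have hF : Module.finrank ℚ F = 2 := by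
    have h := Module.finrank_mul_finrank ℚ F K
    rw [IntermediateField.finrank_fixedField_eq_card, Nat.card_zpowers, hfin] at h
    exact Nat.eq_of_mul_eq_mul_right hσodd.pos h
  have hs0 : s ≠ 0 := by
    rintro rfl
    simp at hs
    exact hd hs
  have hσs : σ s = s := by
    have h : σ s ^ 2 = s ^ 2 := by rw [← map_pow, hs]; simp
    refine (sq_eq_sq_iff_eq_or_eq_neg.mp h).resolve_right fun hneg => hs0 ?_
    have hpow (m : ℕ) : (σ ^ m) s = (-1) ^ m * s := by
      induction m with
      | zero => simp
      | succ m ih => rw [pow_succ', AlgEquiv.mul_apply, ih]; simp [hneg, pow_succ]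
    have h0 := hpow (orderOf σ)
    rwa [pow_orderOf_eq_one, hσodd.neg_one_pow, AlgEquiv.one_apply, neg_one_mul,
      self_eq_neg] at h0
  have hle : IntermediateField.adjoin ℚ {s} ≤ F := by
    rw [IntermediateField.adjoin_simple_le_iff, mem_fixedField_zpowers_iff]
    exact hσs
  apply IntermediateField.eq_of_le_of_finrank_eq hle
  have hdvd := IntermediateField.finrank_dvd_of_le_right hle
  rw [hF] at hdvd ⊢
  refine ((Nat.dvd_prime Nat.prime_two).mp hdvd).resolve_left fun h1 => ?_
  rw [IntermediateField.finrank_adjoin_simple_eq_one_iff, IntermediateField.mem_bot] at h1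
  obtain ⟨q, rfl⟩ := h1
  rw [← map_pow] at hs
  have hq : q ^ 2 = -d := (algebraMap ℚ K).injective (by simpa using hs)
  have : (0 : ℚ) < d := by positivity
  nlinarith [sq_nonneg q]

end Degree

section Exponents

theorem odd_totient_prime_pow_div_two {p e : ℕ} (hp : p.Prime) (hp4 : p % 4 = 3) (he : e ≠ 0) :
    Odd ((p ^ e).totient / 2) ∧ (p ^ e).totient = 2 * ((p ^ e).totient / 2) := by
  obtain ⟨k, rfl⟩ : ∃ k, p = 4 * k + 3 := ⟨p / 4, by omega⟩
  have h : ((4 * k + 3) ^ e).totient = 2 * ((4 * k + 3) ^ (e - 1) * (2 * k + 1)) := by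
    rw [Nat.totient_prime_pow hp (Nat.pos_of_ne_zero he),
      show 4 * k + 3 - 1 = 2 * (2 * k + 1) by omega]
    ring
  rw [h, Nat.mul_div_cancel_left _ two_pos]
  exact ⟨(Odd.pow ⟨2 * k + 1, by ring⟩).mul ⟨k, rfl⟩, rfl⟩

end Exponents

theorem stmt2 (p e : ℕ) (hp : p.Prime) (hp7 : p % 8 = 7) (he : 1 ≤ e)
    (hord : orderOf (2 : ZMod (p ^ e)) = (p ^ e).totient / 2)
    (α : ℂ) (hαmem : α ∈ Algebra.adjoin ℤ ({primRoot (p ^ e)} : Set ℂ))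
    (n : ℕ) (hn : 1 ≤ n)
    (habs : α * (starRingEnd ℂ) α = 2 ^ n) :
    ∃! i : ZMod (p ^ e),
      α * primRoot (p ^ e) ^ (i.val) ∈ IntermediateField.adjoin ℚ ({sqrtNeg p} : Set ℂ) ∧
      IsIntegral ℤ (α * primRoot (p ^ e) ^ (i.val)) := by
  have : Fact p.Prime := ⟨hp⟩
  have he0 : e ≠ 0 := Nat.one_le_iff_ne_zero.mp he
  have hp4 : p % 4 = 3 := by omega
  have hodd : Odd (p ^ e) := (Nat.odd_iff.mpr (by omega)).pow
  have hN2 : 2 < p ^ e :=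
    (show 2 < p by omega).trans_le (Nat.le_self_pow he0 p)
  obtain ⟨hφodd, hφ⟩ := odd_totient_prime_pow_div_two hp hp4 he0
  obtain ⟨K, _, _, _⟩ : ∃ (K : Type) (_ : Field K) (_ : NumberField K),
      IsCyclotomicExtension {p ^ e} ℚ K :=
    ⟨CyclotomicField (p ^ e) ℚ, inferInstance, inferInstance,
      CyclotomicField.isCyclotomicExtension (p ^ e) ℚ⟩
  obtain ⟨ι⟩ : Nonempty (K →+* ℂ) := inferInstance
  have hz : IsPrimitiveRoot (primRoot (p ^ e)) (p ^ e) :=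
    Complex.isPrimitiveRoot_exp _ (NeZero.ne _)
  obtain ⟨ζ, hζ, hιζ⟩ : ∃ ζ : K, IsPrimitiveRoot ζ (p ^ e) ∧ ι ζ = primRoot (p ^ e) := by
    have hζ₀ := IsCyclotomicExtension.zeta_spec (p ^ e) ℚ K
    obtain ⟨i, -, hi⟩ :=
      (hζ₀.map_of_injective ι.injective).eq_pow_of_pow_eq_one hz.pow_eq_one
    rw [← map_pow] at hi
    exact ⟨_, IsPrimitiveRoot.of_map_of_injective (hi ▸ hz) ι.injective, hi⟩
  obtain ⟨σ, hσ, hσord⟩ := exists_algEquiv_apply_eq_pow hζ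
    (ZMod.unitOfCoprime 2 (Nat.coprime_two_left.mpr hodd))
  have hval : (2 : ZMod (p ^ e)).val = 2 := ZMod.val_ofNat_of_lt hN2
  rw [ZMod.coe_unitOfCoprime, Nat.cast_ofNat] at hσ hσord
  rw [hval] at hσ
  rw [← hσord] at hord
  have hσodd : Odd (orderOf σ) := hord ▸ hφodd
  obtain ⟨s, hs, hιs⟩ : ∃ s : K, s ^ 2 = -p ∧ ι s = sqrtNeg p := by
    obtain ⟨s, hs⟩ := exists_sq_eq_neg he0 hp4 hζ
    have h : ι s ^ 2 = sqrtNeg p ^ 2 := by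
      rw [← map_pow, hs, sqrtNeg, mul_pow, Complex.I_sq, ← Complex.ofReal_pow,
        Real.sq_sqrt (Nat.cast_nonneg p)]
      simp
    rcases sq_eq_sq_iff_eq_or_eq_neg.mp h with h | h
    · exact ⟨s, hs, h⟩
    · exact ⟨-s, by rw [neg_sq, hs], by rw [map_neg, h, neg_neg]⟩
  have hfix := adjoin_eq_fixedField_zpowers hσodd (by
    rw [IsCyclotomicExtension.finrank K
      (Polynomial.cyclotomic.irreducible_rat (NeZero.pos (p ^ e))), hord, ← hφ]) hp.ne_zero hs
  have hmem (x : K) : ι x ∈ IntermediateField.adjoin ℚ {sqrtNeg p} ↔ σ x = x := by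
    rw [← mem_fixedField_zpowers_iff, ← hfix, ← hιs]
    have := IntermediateField.adjoin_map ℚ {s} ι.toRatAlgHom
    rw [Set.image_singleton] at this
    change _ ∈ IntermediateField.adjoin ℚ {ι.toRatAlgHom s} ↔ _
    rw [← this]
    exact Function.Injective.mem_set_image ι.injective
  obtain ⟨α, rfl, hαint⟩ : ∃ a : K, ι a = α ∧ IsIntegral ℤ a := by
    have h := AlgHom.map_adjoin_singleton ι.toIntAlgHom ζ
    change _ = Algebra.adjoin ℤ {ι ζ} at h
    rw [hιζ] at h
    rw [← h] at hαmem
    obtain ⟨a, ha, rfl⟩ := hαmem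
    exact ⟨a, rfl, adjoin_le_integralClosure (hζ.isIntegral (NeZero.pos _)) ha⟩
  obtain ⟨r, hr⟩ := exists_apply_eq_pow_mul hodd hζ hσ hσodd ι (α := ⟨α, hαint⟩) habs
  change σ α = ζ ^ r * α at hr
  have hα0 : α ≠ 0 := by
    rintro rfl
    rw [map_zero, zero_mul] at habs
    exact pow_ne_zero n two_ne_zero habs.symm
  have hζ0 : ζ ≠ 0 := hζ.ne_zero (NeZero.ne _)
  have hiff (i : ZMod (p ^ e)) :
      ι α * primRoot (p ^ e) ^ i.val ∈ IntermediateField.adjoin ℚ {sqrtNeg p} ↔ i = -r := by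
    rw [← hιζ, ← map_pow, ← map_mul, hmem, map_mul, map_pow, hr, hσ]
    rw [show ζ ^ r * α * (ζ ^ 2) ^ i.val = ζ ^ (i.val + r) * (α * ζ ^ i.val) by ring,
      mul_eq_right₀ (mul_ne_zero hα0 (pow_ne_zero _ hζ0)), hζ.pow_eq_one_iff_dvd,
      ← ZMod.natCast_eq_zero_iff, Nat.cast_add, ZMod.natCast_zmod_val, eq_neg_iff_add_eq_zero]
  refine ⟨-r, ⟨(hiff _).mpr rfl, ?_⟩, fun i hi => (hiff i).mp hi.1⟩
  exact (hαint.map ι.toIntAlgHom).mul ((hz.isIntegral (NeZero.pos _)).pow _)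
end

section
/- Let p ≡ 7 (mod 8) be a prime, let 𝔭 be a prime ideal of O_L above 2, let t = t_p, and let γ ∈ O_L be a generator of the principal ideal 𝔭^t. Then the set of elements β ∈ O_L satisfying β·β̄ = 2^t is exactly {γ, −γ, γ̄, −γ̄}. -/
open scoped BigOperators nonZeroDivisors

theorem Ideal.IsPrime.intCast_add_mul_mem_iff_even {O : Type*} [CommRing O] {P : Ideal O} (hP : P.IsPrime)
    {ω : O} (h2 : (2 : O) ∈ P) (hω : ω ∈ P) (a b : ℤ) : (a + b * ω : O) ∈ P ↔ Even a := by
  rw [P.add_mem_iff_left (P.mul_mem_left _ hω)]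
  constructor
  · intro ha
    by_contra hodd
    obtain ⟨k, rfl⟩ := Int.not_even_iff_odd.1 hodd
    apply hP.ne_top
    rw [Ideal.eq_top_iff_one]
    have : (1 : O) = ((2 * k + 1 : ℤ) : O) - k * 2 := by push_cast; ring
    rw [this]
    exact P.sub_mem ha (P.mul_mem_left _ h2)
  · rintro ⟨k, rfl⟩
    have : ((k + k : ℤ) : O) = k * 2 := by push_cast; ring
    rw [this]
    exact P.mul_mem_left _ h2

/-- The order `ℤ[ω]` with `ω² = ω - 2m`, together with its conjugation `ω ↦ 1 - ω`. -/
structure IsQuadOrder {O : Type*} [CommRing O] (c : O →+* O) (ω : O) (m : ℤ) : Prop where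
  conj_gen : c ω = 1 - ω
  sq_gen : ω * ω = ω - 2 * (m : O)
  exists_coords : ∀ x : O, ∃ a b : ℤ, x = a + b * ω

namespace IsQuadOrder

section CommRing

variable {O : Type*} [CommRing O] {c : O →+* O} {ω : O} {m : ℤ}

theorem symm (h : IsQuadOrder c ω m) : IsQuadOrder c (1 - ω) m where
  conj_gen := by rw [map_sub, map_one, h.conj_gen]
  sq_gen := by linear_combination h.sq_gen
  exists_coords x := by
    obtain ⟨a, b, rfl⟩ := h.exists_coords x
    exact ⟨a + b, -b, by push_cast; ring⟩

theorem conj_apply (h : IsQuadOrder c ω m) (a b : ℤ) :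
    c (a + b * ω) = a + b * (1 - ω) := by
  rw [map_add, map_mul, map_intCast, map_intCast, h.conj_gen]

theorem conj_conj (h : IsQuadOrder c ω m) (x : O) : c (c x) = x := by
  obtain ⟨a, b, rfl⟩ := h.exists_coords x
  rw [h.conj_apply, map_add, map_mul, map_intCast, map_intCast, map_sub, map_one, h.conj_gen]
  ring

theorem mul_conj (h : IsQuadOrder c ω m) (a b : ℤ) :
    (a + b * ω) * c (a + b * ω) = ((a ^ 2 + a * b + 2 * m * b ^ 2 : ℤ) : O) := by
  rw [h.conj_apply]
  push_cast
  linear_combination (-(b : O) ^ 2) * h.sq_gen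

theorem exists_norm (h : IsQuadOrder c ω m) (hm : 1 ≤ m) (x : O) :
    ∃ n : ℤ, 0 ≤ n ∧ x * c x = n := by
  obtain ⟨a, b, rfl⟩ := h.exists_coords x
  exact ⟨_, by nlinarith [sq_nonneg (2 * a + b), sq_nonneg b], h.mul_conj a b⟩

theorem gen_mem_or (h : IsQuadOrder c ω m) {P : Ideal O} (hP : P.IsPrime)
    (h2 : (2 : O) ∈ P) : ω ∈ P ∨ 1 - ω ∈ P := by
  apply hP.mem_or_mem
  have : ω * (1 - ω) = m * 2 := by linear_combination -h.sq_gen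
  rw [this]
  exact P.mul_mem_left _ h2

theorem isCoprime_comap (h : IsQuadOrder c ω m) {P : Ideal O} (hP : P.IsPrime)
    (h2 : (2 : O) ∈ P) : IsCoprime P (P.comap c) := by
  wlog hω : ω ∈ P generalizing ω
  · exact this h.symm ((h.gen_mem_or hP h2).resolve_left hω)
  rw [Ideal.isCoprime_iff_exists]
  refine ⟨ω, hω, 1 - ω, ?_, by ring⟩
  rw [Ideal.mem_comap, map_sub, map_one, h.conj_gen]
  simpa using hω

theorem mul_comap (h : IsQuadOrder c ω m) {P : Ideal O} (hP : P.IsPrime)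
    (h2 : (2 : O) ∈ P) : P * P.comap c = Ideal.span {2} := by
  wlog hω : ω ∈ P generalizing ω
  · exact this h.symm ((h.gen_mem_or hP h2).resolve_left hω)
  have h2' : (2 : O) ∈ P.comap c := by rwa [Ideal.mem_comap, map_ofNat]
  have hω' : 1 - ω ∈ P.comap c := by
    rw [Ideal.mem_comap, map_sub, map_one, h.conj_gen]
    simpa using hω
  apply le_antisymm
  · rw [Ideal.mul_le]
    intro x hx y hy
    obtain ⟨a, b, rfl⟩ := h.exists_coords x
    obtain ⟨d, e, rfl⟩ := h.exists_coords y
    rw [hP.intCast_add_mul_mem_iff_even h2 hω] at hx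
    rw [Ideal.mem_comap, h.conj_apply] at hy
    have hy' : ((d + e : ℤ) + (-e : ℤ) * ω : O) ∈ P := by
      convert hy using 1
      push_cast; ring
    rw [hP.intCast_add_mul_mem_iff_even h2 hω] at hy'
    obtain ⟨k, hk⟩ := hx
    obtain ⟨l, hl⟩ := hy'
    have hk' : (a : O) = k + k := by exact_mod_cast congrArg (Int.cast : ℤ → O) hk
    have hl' : (d : O) + e = l + l := by exact_mod_cast congrArg (Int.cast : ℤ → O) hl
    rw [Ideal.mem_span_singleton]
    refine ⟨k * d + k * e * ω + b * l * ω - b * e * m, ?_⟩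
    linear_combination (d + e * ω) * hk' + b * ω * hl' + b * e * h.sq_gen
  · rw [Ideal.span_singleton_le_iff_mem]
    have : (2 : O) = ω * 2 + 2 * (1 - ω) := by ring
    rw [this]
    exact add_mem (Ideal.mul_mem_mul hω h2') (Ideal.mul_mem_mul h2 hω')

theorem two_dvd_iff (h : IsQuadOrder c ω m) {P : Ideal O} (hP : P.IsPrime)
    (h2 : (2 : O) ∈ P) (x : O) : 2 ∣ x ↔ x ∈ P ∧ c x ∈ P := by
  rw [← Ideal.mem_span_singleton, ← h.mul_comap hP h2,
    Ideal.mul_eq_inf_of_isCoprime (h.isCoprime_comap hP h2), Submodule.mem_inf, Ideal.mem_comap]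

theorem two_dvd_coords (h : IsQuadOrder c ω m) {P : Ideal O} (hP : P.IsPrime)
    (h2 : (2 : O) ∈ P) {a b : ℤ} (hx : (2 : O) ∣ a + b * ω) : Even b := by
  wlog hω : ω ∈ P generalizing ω a b
  · have := @this (1 - ω) h.symm (a + b) (-b) (by convert hx using 1; push_cast; ring)
      ((h.gen_mem_or hP h2).resolve_left hω)
    simpa using this
  obtain ⟨h₁, h₃⟩ := (h.two_dvd_iff hP h2 _).1 hx
  rw [hP.intCast_add_mul_mem_iff_even h2 hω] at h₁
  rw [h.conj_apply] at h₃
  have h₄ : ((a + b : ℤ) + (-b : ℤ) * ω : O) ∈ P := by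
    convert h₃ using 1
    push_cast; ring
  rw [hP.intCast_add_mul_mem_iff_even h2 hω] at h₄
  grind

theorem not_two_dvd_of_pow_eq_span (h : IsQuadOrder c ω m) {P : Ideal O} (hP : P.IsPrime)
    (h2 : (2 : O) ∈ P) {γ : O} {n : ℕ} (hγ : P ^ n = Ideal.span {γ}) : ¬ 2 ∣ γ := by
  intro h₁
  have hQ : (P.comap c).IsPrime := hP.comap c
  have h₂ : P ^ n ≤ P.comap c := by
    rw [hγ, Ideal.span_singleton_le_iff_mem]
    exact ((h.two_dvd_iff hP h2 γ).1 h₁).2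
  have h₃ := hQ.le_of_pow_le h₂
  have h₄ := Ideal.isCoprime_iff_sup_eq.1 (h.isCoprime_comap hP h2)
  rw [sup_eq_right.2 h₃] at h₄
  exact hQ.ne_top h₄

variable [CharZero O]

theorem eq_one_or_neg_one_of_isUnit (h : IsQuadOrder c ω m) (hm : 1 ≤ m) {u : O}
    (hu : IsUnit u) : u = 1 ∨ u = -1 := by
  obtain ⟨v, huv⟩ := hu.exists_right_inv
  obtain ⟨k, hk, hvk⟩ := h.exists_norm hm v
  obtain ⟨a, b, rfl⟩ := h.exists_coords u
  have hN := h.mul_conj a b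
  have h₁ : ((a ^ 2 + a * b + 2 * m * b ^ 2) * k : ℤ) = 1 := by
    have : (((a ^ 2 + a * b + 2 * m * b ^ 2) * k : ℤ) : O) = (1 : ℤ) := by
      rw [Int.cast_mul, ← hN, ← hvk]
      have hc := congrArg c huv
      rw [map_mul, map_one] at hc
      rw [mul_mul_mul_comm, huv, hc]
      simp
    exact_mod_cast this
  have h₂ : a ^ 2 + a * b + 2 * m * b ^ 2 = 1 := by
    rcases Int.eq_one_or_neg_one_of_mul_eq_one h₁ with h₃ | h₃
    · exact h₃
    · nlinarith [sq_nonneg (2 * a + b), sq_nonneg b]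
  have hb : b = 0 := by
    by_contra hb
    have : 0 < b ^ 2 := by positivity
    nlinarith [sq_nonneg (2 * a + b)]
  subst hb
  have ha : (a - 1) * (a + 1) = 0 := by linarith
  rcases mul_eq_zero.1 ha with ha | ha
  · left
    rw [show a = 1 by omega]; simp
  · right
    rw [show a = -1 by omega]; simp

variable [IsDomain O]

theorem eq_or_eq_neg_of_span_eq (h : IsQuadOrder c ω m) (hm : 1 ≤ m) {x y : O}
    (hxy : Ideal.span {x} = Ideal.span {y}) : x = y ∨ x = -y := by
  obtain ⟨u, hu⟩ := Ideal.span_singleton_eq_span_singleton.1 hxy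
  rcases h.eq_one_or_neg_one_of_isUnit hm u.isUnit with h₁ | h₁
  · left; rw [← hu, h₁, mul_one]
  · right; rw [← hu, h₁]; ring

theorem mul_conj_of_span_eq_pow (h : IsQuadOrder c ω m) (hm : 1 ≤ m) {P : Ideal O}
    (hP : P.IsPrime) (h2 : (2 : O) ∈ P) {γ : O} {n : ℕ} (hγ : P ^ n = Ideal.span {γ}) :
    γ * c γ = 2 ^ n := by
  have hmap : P.map c = P.comap c := by
    apply le_antisymm
    · rw [Ideal.map_le_iff_le_comap]
      intro x hx
      simpa [h.conj_conj] using hx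
    · intro x hx
      rw [← h.conj_conj x]
      exact Ideal.mem_map_of_mem c hx
  have h₁ : Ideal.span {γ * c γ} = Ideal.span {(2 : O) ^ n} := by
    rw [← Ideal.span_singleton_mul_span_singleton, ← Ideal.span_singleton_pow,
      ← h.mul_comap hP h2, mul_pow, hγ, ← hmap, ← Ideal.map_pow, hγ, Ideal.map_span,
      Set.image_singleton]
  obtain ⟨k, hk, hγk⟩ := h.exists_norm hm γ
  rcases h.eq_or_eq_neg_of_span_eq hm h₁ with h₃ | h₃
  · exact h₃
  · exfalso
    rw [hγk] at h₃
    have : k = -2 ^ n := Int.cast_injective (α := O) (by rw [h₃]; push_cast; rfl)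
    have : (0 : ℤ) < 2 ^ n := by positivity
    omega

end CommRing

section Dedekind

variable {O : Type*} [CommRing O] [IsDedekindDomain O] [CharZero O]
  {c : O →+* O} {ω : O} {m : ℤ}

theorem pow_eq_span_of_notMem (h : IsQuadOrder c ω m) {P : Ideal O} (hP : P.IsPrime)
    (h2 : (2 : O) ∈ P) {x : O} {n : ℕ} (hx : x * c x = 2 ^ n) (hcx : c x ∉ P) :
    P ^ n = Ideal.span {x} := by
  have hmax {Q : Ideal O} (hQ : Q.IsPrime) (h2Q : (2 : O) ∈ Q) : Q.IsMaximal :=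
    hQ.isMaximal (by rintro rfl; exact two_ne_zero (Ideal.mem_bot.1 h2Q))
  have hQ : (P.comap c).IsPrime := hP.comap c
  have hcop {Q : Ideal O} (hQ : Q.IsPrime) (h2Q : (2 : O) ∈ Q) {y : O} (hy : y ∉ Q) :
      IsCoprime (Q ^ n) (Ideal.span {y}) := by
    apply IsCoprime.pow_left
    rw [Ideal.isCoprime_iff_sup_eq]
    apply (hmax hQ h2Q).out.2
    rw [left_lt_sup, Ideal.span_singleton_le_iff_mem]
    exact hy
  have hprod : P ^ n * P.comap c ^ n = Ideal.span {x} * Ideal.span {c x} := by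
    rw [← mul_pow, h.mul_comap hP h2, Ideal.span_singleton_mul_span_singleton, hx,
      Ideal.span_singleton_pow]
  apply dvd_antisymm
  · exact (hcop hP h2 hcx).dvd_of_dvd_mul_right (hprod ▸ dvd_mul_right _ _)
  · exact (hcop hQ (by rwa [Ideal.mem_comap, map_ofNat]) (y := x) hcx).symm.dvd_of_dvd_mul_right
      (hprod ▸ dvd_mul_right _ _)

theorem pow_eq_span_or (h : IsQuadOrder c ω m) {P : Ideal O} (hP : P.IsPrime)
    (h2 : (2 : O) ∈ P) {x : O} {n : ℕ} (hx : x * c x = 2 ^ n) (hx2 : ¬ 2 ∣ x) :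
    P ^ n = Ideal.span {x} ∨ P ^ n = Ideal.span {c x} := by
  rw [h.two_dvd_iff hP h2, not_and_or] at hx2
  rcases hx2 with h₁ | h₁
  · right
    apply h.pow_eq_span_of_notMem hP h2
    · rw [h.conj_conj, mul_comm, hx]
    · rwa [h.conj_conj]
  · left
    exact h.pow_eq_span_of_notMem hP h2 hx h₁

end Dedekind

end IsQuadOrder

theorem exists_odd_sq_add_mul_sq_of_sq {p u v : ℤ} (hp : Prime p) (hp0 : 0 < p) {s : ℕ}
    (hu : Odd u) (hv : Odd v) (h : u ^ 2 + p * v ^ 2 = 2 ^ (2 * s + 2)) :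
    ∃ e f : ℤ, Odd e ∧ Odd f ∧ f ^ 2 + p * e ^ 2 = 2 ^ (s + 2) := by
  have hmul : (2 ^ (s + 1) - u) * (2 ^ (s + 1) + u) = p * v ^ 2 := by
    have : (2 : ℤ) ^ (2 * s + 2) = 2 ^ (s + 1) * 2 ^ (s + 1) := by ring
    linear_combination -h + this
  wlog hdvd : p ∣ 2 ^ (s + 1) - u generalizing u
  · apply @this (-u) hu.neg (by rw [← h]; ring) (by rw [← hmul]; ring)
    have : p ∣ (2 ^ (s + 1) - u) * (2 ^ (s + 1) + u) := ⟨_, hmul⟩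
    simpa using (hp.dvd_or_dvd this).resolve_left hdvd
  obtain ⟨A, hA⟩ := hdvd
  have hAB : A * (2 ^ (s + 1) + u) = v ^ 2 := by
    apply mul_left_cancel₀ hp.ne_zero
    rw [← hmul, hA]; ring
  have hBodd : Odd (2 ^ (s + 1) + u) := by
    apply Even.add_odd _ hu
    exact (even_two).pow_of_ne_zero (by omega)
  have hcop : IsCoprime A (2 ^ (s + 1) + u) := by
    have h2 : IsCoprime (2 ^ (s + 2) : ℤ) (2 ^ (s + 1) + u) := by
      apply IsCoprime.pow_left
      rw [Int.isCoprime_iff_gcd_eq_one]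
      obtain ⟨k, hk⟩ := hBodd
      rw [hk]
      simp
    have h3 : IsCoprime (p * A) (2 ^ (s + 1) + u) := by
      have : p * A = 2 ^ (s + 2) + (2 ^ (s + 1) + u) * (-1) := by rw [← hA]; ring
      rw [this]
      exact h2.add_mul_left_left _
    exact h3.of_mul_left_right
  have hv2 : 0 < v ^ 2 := by
    have : v ≠ 0 := by rintro rfl; simp at hv
    positivity
  have hsum : p * A + (2 ^ (s + 1) + u) = 2 ^ (s + 2) := by rw [← hA]; ring
  have hpos : 0 < (2 : ℤ) ^ (s + 2) := by positivity
  have hApos : 0 < A := by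
    by_contra hneg
    have hB : 2 ^ (s + 1) + u < 0 := by nlinarith
    nlinarith
  have hBpos : 0 < 2 ^ (s + 1) + u := by nlinarith
  obtain ⟨e, he | he⟩ := Int.sq_of_isCoprime hcop hAB
  swap
  · nlinarith [sq_nonneg e]
  obtain ⟨f, hf | hf⟩ := Int.sq_of_isCoprime hcop.symm ((mul_comm _ _).trans hAB)
  swap
  · nlinarith [sq_nonneg f]
  refine ⟨e, f, ?_, ?_, by rw [← hsum, he, hf]; ring⟩
  · have : Odd (A * (2 ^ (s + 1) + u)) := by rw [hAB]; exact hv.pow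
    have := (Int.odd_mul.1 this).1
    rw [he] at this
    exact (Int.odd_pow' two_ne_zero).1 this
  · rw [hf] at hBodd
    exact (Int.odd_pow' two_ne_zero).1 hBodd

namespace IsQuadOrder

variable {O : Type*} [CommRing O] [IsDedekindDomain O] [CharZero O]
  {c : O →+* O} {ω : O} {m : ℤ}

theorem odd_of_principal_pow (h : IsQuadOrder c ω m) (hm : 1 ≤ m) (hp : Prime (8 * m - 1))
    {P : Ideal O} (hP : P.IsPrime) (h2 : (2 : O) ∈ P) {t : ℕ} (ht : 0 < t)
    (hdvd : ∀ n x, P ^ n = Ideal.span {x} → t ∣ n) {γ : O} (hγ : P ^ t = Ideal.span {γ}) :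
    Odd t := by
  by_contra hodd
  obtain ⟨s, rfl⟩ := Nat.not_odd_iff_even.1 hodd
  have hN := h.mul_conj_of_span_eq_pow hm hP h2 hγ
  have hγ2 := h.not_two_dvd_of_pow_eq_span hP h2 hγ
  obtain ⟨a, b, rfl⟩ := h.exists_coords γ
  rw [h.mul_conj] at hN
  have hN' : a ^ 2 + a * b + 2 * m * b ^ 2 = 2 ^ (s + s) := by exact_mod_cast hN
  have hb : Odd b := by
    by_contra hb
    obtain ⟨k, rfl⟩ := Int.not_odd_iff_even.1 hb
    have ha : Even (a ^ 2) := by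
      have : Even ((2 : ℤ) ^ (s + s)) := even_two.pow_of_ne_zero (by omega)
      rw [← hN'] at this
      grind
    obtain ⟨l, rfl⟩ := (Int.even_pow.1 ha).1
    exact hγ2 ⟨l + k * ω, by push_cast; ring⟩
  obtain ⟨e, f, he, hf, hef⟩ := exists_odd_sq_add_mul_sq_of_sq (u := 2 * a + b) (v := b) (s := s)
    hp (by linarith) (by grind) hb (by
      rw [pow_add, two_mul s, ← hN']; ring)
  obtain ⟨g, hg⟩ : Even (f - e) := hf.sub_odd he
  have hf' : f = 2 * g + e := by linarith
  subst hf'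
  have hδ : (g + e * ω : O) * c (g + e * ω) = 2 ^ s := by
    rw [h.mul_conj]
    have : g ^ 2 + g * e + 2 * m * e ^ 2 = 2 ^ s := by
      rw [pow_add] at hef
      linarith
    exact_mod_cast this
  have hs : s + s ∣ s := by
    rcases h.pow_eq_span_or hP h2 hδ (fun hd => by
      have := h.two_dvd_coords hP h2 hd
      exact Int.not_even_iff_odd.2 he this) with h₁ | h₁
    · exact hdvd _ _ h₁
    · exact hdvd _ _ h₁
  have := Nat.le_of_dvd (by omega) hs
  omega

theorem exists_two_pow_mul (h : IsQuadOrder c ω m) (hm : 1 ≤ m) (n : ℕ) (x : O) (hx : x * c x = 2 ^ n) :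
    ∃ k l : ℕ, ∃ y : O, x = 2 ^ k * y ∧ n = 2 * k + l ∧ y * c y = 2 ^ l ∧ ¬ 2 ∣ y := by
  induction n using Nat.strong_induction_on generalizing x with
  | _ n ih =>
  by_cases hx2 : 2 ∣ x
  · obtain ⟨y, rfl⟩ := hx2
    obtain ⟨j, -, hj⟩ := h.exists_norm hm y
    have h4 : 4 * (y * c y) = 2 ^ n := by
      rw [← hx, map_mul, map_ofNat]; ring
    have hj4 : 4 * j = 2 ^ n := by
      rw [hj] at h4
      exact_mod_cast h4
    have hn : 2 ≤ n := by
      by_contra hn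
      interval_cases n <;> omega
    obtain ⟨n, rfl⟩ := Nat.exists_eq_add_of_le' hn
    have hy : y * c y = 2 ^ n := by
      apply mul_left_cancel₀ (OfNat.ofNat_ne_zero 4 : (4 : O) ≠ 0)
      rw [h4]; ring
    obtain ⟨k, l, z, rfl, rfl, hz, hz2⟩ := ih n (by omega) y hy
    exact ⟨k + 1, l, z, by ring, by ring, hz, hz2⟩
  · exact ⟨0, n, x, by simp, by simp, hx, hx2⟩

theorem mul_conj_eq_two_pow_iff (h : IsQuadOrder c ω m) (hm : 1 ≤ m) (hp : Prime (8 * m - 1))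
    {P : Ideal O} (hP : P.IsPrime) (h2 : (2 : O) ∈ P) {t : ℕ} (ht : 0 < t)
    (hdvd : ∀ n x, P ^ n = Ideal.span {x} → t ∣ n) {γ : O} (hγ : P ^ t = Ideal.span {γ})
    (x : O) : x * c x = 2 ^ t ↔ x = γ ∨ x = -γ ∨ x = c γ ∨ x = -c γ := by
  constructor
  · intro hx
    have hodd := h.odd_of_principal_pow hm hp hP h2 ht hdvd hγ
    obtain ⟨k, l, y, rfl, hkl, hy, hy2⟩ := h.exists_two_pow_mul hm t x hx
    have hspan := h.pow_eq_span_or hP h2 hy hy2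
    have htl : t ∣ l := hspan.elim (hdvd _ _) (hdvd _ _)
    have hl : l ≠ 0 := by
      rintro rfl
      subst hkl
      exact Nat.not_odd_iff_even.2 (even_two_mul k) hodd
    have := Nat.le_of_dvd (by omega) htl
    obtain rfl : k = 0 := by omega
    obtain rfl : l = t := by omega
    rw [pow_zero, one_mul]
    rcases hspan with h₁ | h₁
    · rcases h.eq_or_eq_neg_of_span_eq hm (h₁.symm.trans hγ) with h₃ | h₃
      · exact Or.inl h₃
      · exact Or.inr (Or.inl h₃)
    · rw [← h.conj_conj y]
      rcases h.eq_or_eq_neg_of_span_eq hm (h₁.symm.trans hγ) with h₃ | h₃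
      · exact Or.inr (Or.inr (Or.inl (by rw [h₃])))
      · exact Or.inr (Or.inr (Or.inr (by rw [h₃, map_neg])))
  · have hN := h.mul_conj_of_span_eq_pow hm hP h2 hγ
    rintro (rfl | rfl | rfl | rfl)
    · exact hN
    · rw [map_neg, neg_mul_neg, hN]
    · rw [h.conj_conj, mul_comm, hN]
    · rw [map_neg, h.conj_conj, neg_mul_neg, mul_comm, hN]

end IsQuadOrder

theorem Rat.exists_int_of_isIntegral_cast {q : ℚ} (hq : IsIntegral ℤ (q : ℂ)) :
    ∃ n : ℤ, (n : ℚ) = q := by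
  have : IsIntegral ℤ q :=
    (isIntegral_algebraMap_iff (algebraMap ℚ ℂ).injective).1 (by simpa using hq)
  obtain ⟨n, hn⟩ := IsIntegrallyClosed.isIntegral_iff.1 this
  exact ⟨n, by simpa using hn⟩

theorem Complex.conj_eq_neg_of_sq_eq_neg {z : ℂ} {r : ℝ} (hr : 0 < r) (hz : z ^ 2 = -(r : ℂ)) :
    (starRingEnd ℂ) z = -z := by
  have h1 := congrArg Complex.re hz
  have h2 := congrArg Complex.im hz
  simp [sq] at h1 h2
  have h3 : z.re * z.im = 0 := by linarith
  have hre : z.re = 0 := by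
    rcases mul_eq_zero.1 h3 with h | h
    · exact h
    · rw [h] at h1
      nlinarith [sq_nonneg z.re]
  apply Complex.ext <;> simp [hre]

theorem exists_rat_coords_of_adjoin_eq_top {K : Type*} [Field K] [CharZero K] {α : K} {d : ℚ}
    (hα : α ^ 2 = (d : K)) (hgen : Algebra.adjoin ℚ ({α} : Set K) = ⊤) (x : K) :
    ∃ a b : ℚ, x = a + b * α := by
  have hx : x ∈ Algebra.adjoin ℚ ({α} : Set K) := hgen ▸ Algebra.mem_top
  induction hx using Algebra.adjoin_induction with
  | mem x hx =>
    rw [Set.mem_singleton_iff] at hx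
    exact ⟨0, 1, by simp [hx]⟩
  | algebraMap r => exact ⟨r, 0, by simp⟩
  | add x y _ _ hx hy =>
    obtain ⟨a, b, rfl⟩ := hx
    obtain ⟨a', b', rfl⟩ := hy
    exact ⟨a + a', b + b', by push_cast; ring⟩
  | mul x y _ _ hx hy =>
    obtain ⟨a, b, rfl⟩ := hx
    obtain ⟨a', b', rfl⟩ := hy
    exact ⟨a * a' + d * b * b', a * b' + b * a', by
      push_cast; linear_combination (b : K) * b' * hα⟩

/-- Half-integrality of the coordinates of an algebraic integer of `ℚ(√-p)`, `p ≡ 3 (mod 4)`. -/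
theorem exists_int_half_coords {p : ℕ} (hp : p.Prime) (hp4 : p % 4 = 3) {a b : ℚ}
    {u n : ℤ} (hu : (u : ℚ) = 2 * a) (hn : (n : ℚ) = a ^ 2 + p * b ^ 2) :
    ∃ k v : ℤ, a = k + v / 2 ∧ b = v / 2 := by
  have hk : (2 * p * b) ^ 2 = ((p * (4 * n - u ^ 2) : ℤ) : ℚ) := by
    push_cast
    rw [hu, hn]; ring
  obtain ⟨w, hw⟩ : ∃ w : ℤ, (w : ℚ) = 2 * p * b := by
    have : IsIntegral ℤ (2 * p * b : ℚ) := by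
      apply IsIntegral.of_pow (n := 2) (by norm_num)
      rw [hk]
      exact isIntegral_algebraMap (R := ℤ) (A := ℚ)
    obtain ⟨w, hw⟩ := IsIntegrallyClosed.isIntegral_iff.1 this
    exact ⟨w, by simpa using hw⟩
  rw [← hw] at hk
  have hk' : w ^ 2 = p * (4 * n - u ^ 2) := by exact_mod_cast hk
  have hpw : (p : ℤ) ∣ w := (Nat.prime_iff_prime_int.1 hp).dvd_of_dvd_pow ⟨_, hk'⟩
  obtain ⟨v, rfl⟩ := hpw
  have hp0 : (p : ℚ) ≠ 0 := by exact_mod_cast hp.ne_zero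
  have hv : (v : ℚ) = 2 * b := by
    apply mul_left_cancel₀ hp0
    push_cast at hw
    rw [hw]; ring
  have hN : u ^ 2 + p * v ^ 2 = 4 * n := by
    have : (u : ℚ) ^ 2 + p * v ^ 2 = 4 * n := by rw [hu, hv, hn]; ring
    exact_mod_cast this
  obtain ⟨k, hk⟩ : Even (u - v) := by
    have hodd : ¬ Even (p : ℤ) := by
      rw [Int.even_iff]; omega
    have : Even (u ^ 2 + p * v ^ 2) := by rw [hN]; exact ⟨2 * n, by ring⟩
    rw [Int.even_add, Int.even_mul, Int.even_pow' two_ne_zero, Int.even_pow' two_ne_zero] at this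
    rw [Int.even_sub]
    tauto
  refine ⟨k, v, ?_, by rw [hv]; ring⟩
  have : (u : ℚ) - v = k + k := by exact_mod_cast hk
  linarith

theorem exists_isQuadOrder_ringOfIntegers {p : ℕ} (hp : p.Prime) {m : ℕ} (hpm : p + 1 = 8 * m)
    {K : Type*} [Field K] [NumberField K] (σ : K →+* ℂ) {α : K} (hα : α ^ 2 = -(p : K))
    (hgen : Algebra.adjoin ℚ ({α} : Set K) = ⊤) :
    ∃ (c : NumberField.RingOfIntegers K →+* NumberField.RingOfIntegers K)
      (ω : NumberField.RingOfIntegers K), IsQuadOrder c ω m ∧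
      ∀ x : NumberField.RingOfIntegers K, σ (c x : K) = (starRingEnd ℂ) (σ (x : K)) := by
  have hpm' : (p : K) + 1 = 8 * m := by exact_mod_cast hpm
  have hconj : (starRingEnd ℂ) (σ α) = -σ α := by
    apply Complex.conj_eq_neg_of_sq_eq_neg (r := p) (by exact_mod_cast hp.pos)
    rw [← map_pow, hα]; simp
  have hsq : ((1 + α) / 2) * ((1 + α) / 2) = (1 + α) / 2 - 2 * (m : K) := by
    linear_combination hα / 4 - hpm' / 4
  have hint : IsIntegral ℤ ((1 + α) / 2) := by
    refine ⟨Polynomial.X ^ 2 + (-Polynomial.X + Polynomial.C (2 * m : ℤ)), ?_, ?_⟩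
    · apply Polynomial.monic_X_pow_add
      compute_degree!
    · simp
      linear_combination hsq
  obtain ⟨ω, hω⟩ : ∃ ω : NumberField.RingOfIntegers K, (ω : K) = (1 + α) / 2 :=
    ⟨⟨(1 + α) / 2, hint⟩, rfl⟩
  have hωconj : (starRingEnd ℂ) (σ (ω : K)) = 1 - σ (ω : K) := by
    rw [hω, map_div₀, map_ofNat, map_add, map_one, map_div₀, map_add, map_one, map_ofNat, hconj]
    ring
  have hcoords : ∀ x : NumberField.RingOfIntegers K, ∃ a b : ℤ, x = a + b * ω := by
    intro x
    obtain ⟨a, b, hab⟩ := exists_rat_coords_of_adjoin_eq_top (d := -p) (by simpa using hα) hgen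
      (x : K)
    have hσ : σ (x : K) = a + b * σ α := by rw [hab]; simp
    have hσ' : (starRingEnd ℂ) (σ (x : K)) = a - b * σ α := by
      rw [hσ, map_add, map_mul, hconj]
      simp [sub_eq_add_neg]
    have hi : IsIntegral ℤ (σ (x : K)) := map_isIntegral_int σ x.isIntegral_coe
    have hi' : IsIntegral ℤ ((starRingEnd ℂ) (σ (x : K))) := map_isIntegral_int _ hi
    have hσα : σ α ^ 2 = -(p : ℂ) := by rw [← map_pow, hα]; simp
    obtain ⟨u, hu⟩ := Rat.exists_int_of_isIntegral_cast (q := 2 * a) (by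
      have : ((2 * a : ℚ) : ℂ) = σ (x : K) + (starRingEnd ℂ) (σ (x : K)) := by
        rw [hσ', hσ]; push_cast; ring
      rw [this]
      exact hi.add hi')
    obtain ⟨n, hn⟩ := Rat.exists_int_of_isIntegral_cast (q := a ^ 2 + p * b ^ 2) (by
      have : ((a ^ 2 + p * b ^ 2 : ℚ) : ℂ) = σ (x : K) * (starRingEnd ℂ) (σ (x : K)) := by
        rw [hσ', hσ]; push_cast; linear_combination (b : ℂ) ^ 2 * hσα
      rw [this]
      exact hi.mul hi')
    obtain ⟨k, v, rfl, rfl⟩ := exists_int_half_coords hp (by omega) hu hn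
    refine ⟨k, v, NumberField.RingOfIntegers.ext ?_⟩
    rw [hab]
    simp [hω]
    ring
  have hex : ∀ x : NumberField.RingOfIntegers K, ∃ y : NumberField.RingOfIntegers K,
      σ (y : K) = (starRingEnd ℂ) (σ (x : K)) := by
    intro x
    obtain ⟨a, b, rfl⟩ := hcoords x
    exact ⟨a + b * (1 - ω), by simp [hωconj]⟩
  choose f hf using hex
  have hinj {x y : NumberField.RingOfIntegers K} (h : σ (x : K) = σ (y : K)) : x = y :=
    NumberField.RingOfIntegers.ext (σ.injective h)
  refine ⟨{ toFun := f
            map_one' := hinj (by rw [hf]; simp)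
            map_zero' := hinj (by rw [hf]; simp)
            map_mul' := fun x y => hinj (by simp [hf])
            map_add' := fun x y => hinj (by simp [hf]) }, ω, ⟨?_, ?_, hcoords⟩, hf⟩
  · apply hinj
    change σ (f ω : K) = _
    rw [hf, hωconj]
    simp
  · apply NumberField.RingOfIntegers.ext
    simpa [hω, map_ofNat (algebraMap (NumberField.RingOfIntegers K) K) 2] using hsq

theorem orderOf_mk0_dvd_of_pow_eq_span {R : Type*} [CommRing R] [IsDedekindDomain R]
    {P : Ideal R} (hP0 : P ∈ (Ideal R)⁰) {n : ℕ} {x : R} (hx : P ^ n = Ideal.span {x}) :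
    orderOf (ClassGroup.mk0 ⟨P, hP0⟩) ∣ n := by
  rw [orderOf_dvd_iff_pow_eq_one, ← map_pow, ClassGroup.mk0_eq_one_iff]
  exact ⟨x, by simpa using hx⟩

theorem stmt4 (p : ℕ) (hp : p.Prime) (hp7 : p % 8 = 7)
    (K : Type) [Field K] [NumberField K] (σ : K →+* ℂ)
    (α : K) (hα : α ^ 2 = -(p : K))
    (hgen : Algebra.adjoin ℚ ({α} : Set K) = ⊤)
    (𝔭 : Ideal (NumberField.RingOfIntegers K)) (hP : 𝔭.IsPrime)
    (hP0 : 𝔭 ∈ (Ideal (NumberField.RingOfIntegers K))⁰)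
    (h2 : (2 : NumberField.RingOfIntegers K) ∈ 𝔭)
    (t : ℕ) (ht : t = orderOf (ClassGroup.mk0 ⟨𝔭, hP0⟩))
    (γ : NumberField.RingOfIntegers K) (hγ : 𝔭 ^ t = Ideal.span {γ}) :
    {z : ℂ | (∃ β : NumberField.RingOfIntegers K, σ (β : K) = z) ∧
        z * (starRingEnd ℂ) z = 2 ^ t}
      = {σ (γ : K), -σ (γ : K),
         (starRingEnd ℂ) (σ (γ : K)), -(starRingEnd ℂ) (σ (γ : K))} := by
  obtain ⟨m, hpm⟩ : ∃ m, p + 1 = 8 * m := ⟨(p + 1) / 8, by omega⟩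
  obtain ⟨c, ω, h, hc⟩ := exists_isQuadOrder_ringOfIntegers hp hpm σ hα hgen
  have hprime : Prime (8 * (m : ℤ) - 1) := by
    rw [show 8 * (m : ℤ) - 1 = p by omega]
    exact Nat.prime_iff_prime_int.1 hp
  have hinj : Function.Injective fun x : NumberField.RingOfIntegers K => σ (x : K) :=
    σ.injective.comp NumberField.RingOfIntegers.coe_injective
  have key := h.mul_conj_eq_two_pow_iff (by omega) hprime hP h2
    (ht ▸ orderOf_pos _) (fun n x hx => ht ▸ orderOf_mk0_dvd_of_pow_eq_span hP0 hx) hγ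
  have hmul (β : NumberField.RingOfIntegers K) :
      σ (β : K) * (starRingEnd ℂ) (σ (β : K)) = 2 ^ t ↔ β * c β = 2 ^ t := by
    rw [← hinj.eq_iff]
    simp [hc, map_ofNat (algebraMap (NumberField.RingOfIntegers K) K) 2, map_ofNat σ 2]
  have hneg (x : NumberField.RingOfIntegers K) : -σ (x : K) = σ ((-x : _) : K) := by simp
  ext z
  simp only [Set.mem_ofPred_eq, Set.mem_insert_iff, Set.mem_singleton_iff]
  rw [← hc, hneg, hneg]
  constructor
  · rintro ⟨⟨β, rfl⟩, hβ⟩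
    rcases (key β).1 ((hmul β).1 hβ) with rfl | rfl | rfl | rfl <;> simp
  · rintro (rfl | rfl | rfl | rfl) <;>
    exact ⟨⟨_, rfl⟩, (hmul _).2 ((key _).2 (by simp))⟩
end
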